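/- In a right-angled Coxeter group W, if x₁, x₂ ⋖ y₁, y₂ form a butterfly and w ∈ W satisfies w ≥ y₁ and w ≥ y₂ in Bruhat order, then there exists z ∈ W covering both y₁ and y₂ with z ≤ w. -/

import Mathlib

open CoxeterSystem

variable {B W : Type*} [Group W] {M : CoxeterMatrix B}

/-- One step of Bruhat order: multiply on the right by a reflection, increasing length. -/
def bruhatStep (cs : CoxeterSystem M W) (x y : W) : Prop :=
  ∃ t : W, cs.IsReflection t ∧ y = x * t ∧ cs.length x < cs.length y

/-- Bruhat order on a Coxeter group. -/
def bruhatLE (cs : CoxeterSystem M W) : W → W → Prop :=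
  Relation.ReflTransGen (bruhatStep cs)

/-- Strict Bruhat order. -/
def bruhatLT (cs : CoxeterSystem M W) (x y : W) : Prop :=
  bruhatLE cs x y ∧ x ≠ y

/-- Cover relation in Bruhat order. -/
def bruhatCovBy (cs : CoxeterSystem M W) (x y : W) : Prop :=
  bruhatLE cs x y ∧ cs.length y = cs.length x + 1

/-- The Bruhat interval `[u, v]`. -/
def bruhatInterval (cs : CoxeterSystem M W) (u v : W) : Set W :=
  {x | bruhatLE cs u x ∧ bruhatLE cs x v}

/-- The support of `w`: simple reflections appearing in a reduced word for `w`. -/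
def supp (cs : CoxeterSystem M W) (w : W) : Set B :=
  {i | ∃ ω : List B, cs.IsReduced ω ∧ w = cs.wordProd ω ∧ i ∈ ω}

namespace CoxeterSystem

/-- A Coxeter matrix is right-angled if its off-diagonal entries are `2` or `0` (standing for `∞`). -/
def IsRightAngled (M : CoxeterMatrix B) : Prop :=
  ∀ i j : B, i ≠ j → M i j = 2 ∨ M i j = 0

variable (cs : CoxeterSystem M W)

theorem simple_commute {i j : B} (hij : M i j = 2) :
    cs.simple i * cs.simple j = cs.simple j * cs.simple i := by
  have h : cs.simple i * cs.simple j * (cs.simple i * cs.simple j) = 1 := by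
    rw [← pow_two, ← hij, cs.simple_mul_simple_pow]
  simpa using eq_inv_of_mul_eq_one_left h

/-! ### Signed action on reflections -/

open Classical in
/-- The indicator of a simple reflection, with values in `ZMod 2`. -/
noncomputable def simpleSign (i : B) (t : W) : ZMod 2 := if t = cs.simple i then 1 else 0

theorem simpleSign_congr {i : B} {t u : W} (h : t = cs.simple i ↔ u = cs.simple i) :
    cs.simpleSign i t = cs.simpleSign i u := by
  unfold simpleSign
  split_ifs <;> tauto

/-- The action of a simple reflection on pairs of an element `t` and a sign, which conjugates `t`
and changes the sign exactly when `t` is that simple reflection. -/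
noncomputable def signedConj (i : B) : Function.End (W × ZMod 2) := fun p ↦
  (cs.simple i * p.1 * cs.simple i, p.2 + cs.simpleSign i p.1)

theorem signedConj_mul_self (i : B) : cs.signedConj i * cs.signedConj i = 1 := by
  funext ⟨t, e⟩
  have h : cs.simple i * t * cs.simple i = cs.simple i ↔ t = cs.simple i := by
    constructor
    · intro h
      have := congrArg (fun u ↦ cs.simple i * u * cs.simple i) h
      simpa [mul_assoc] using this
    · rintro rfl
      simp
  change cs.signedConj i (cs.signedConj i (t, e)) = (t, e)
  simp only [signedConj, cs.simpleSign_congr h]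
  simp [mul_assoc, add_assoc, CharTwo.add_self_eq_zero]

theorem signedConj_commute {i j : B} (hij : M i j = 2) :
    cs.signedConj i * cs.signedConj j = cs.signedConj j * cs.signedConj i := by
  have key : ∀ {i j : B}, M i j = 2 → ∀ t : W,
      (cs.simple j * t * cs.simple j = cs.simple i ↔ t = cs.simple i) := by
    intro i j hij t
    have hc := cs.simple_commute hij
    constructor
    · intro h
      have := congrArg (fun u ↦ cs.simple j * u * cs.simple j) h
      simpa [mul_assoc, hc] using this
    · rintro rfl
      rw [← hc]
      simp
  funext ⟨t, e⟩
  have hc := cs.simple_commute hij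
  change cs.signedConj i (cs.signedConj j (t, e)) = cs.signedConj j (cs.signedConj i (t, e))
  simp only [signedConj, cs.simpleSign_congr (key hij t),
    cs.simpleSign_congr (key ((M.symmetric j i).trans hij) t)]
  refine Prod.ext ?_ (add_right_comm _ _ _)
  simp only [← mul_assoc, hc]
  simp only [mul_assoc, hc]

theorem isLiftable_signedConj (hra : IsRightAngled M) : M.IsLiftable cs.signedConj := by
  intro i j
  rcases eq_or_ne i j with rfl | hij
  · simp [signedConj_mul_self]
  · rcases hra i j hij with h | h
    · rw [h, pow_two]
      nth_rw 2 [cs.signedConj_commute h]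
      rw [mul_assoc, ← mul_assoc (cs.signedConj j), signedConj_mul_self, one_mul,
        signedConj_mul_self]
    · rw [h, pow_zero]

/-- The action of `W` on pairs of an element and a sign extending `signedConj`. -/
noncomputable def signedConjHom (hra : IsRightAngled M) : W →* Function.End (W × ZMod 2) :=
  cs.lift ⟨cs.signedConj, cs.isLiftable_signedConj hra⟩

/-- The sign change of `t` under `w`; it is `1` exactly if `t` is a right inversion of `w`. -/
noncomputable def invParity (hra : IsRightAngled M) (w t : W) : ZMod 2 :=
  (cs.signedConjHom hra w (t, 0)).2

variable {cs}

theorem signedConjHom_simple_mul (hra : IsRightAngled M) (i : B) (w : W) (p : W × ZMod 2) :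
    cs.signedConjHom hra (cs.simple i * w) p = cs.signedConj i (cs.signedConjHom hra w p) := by
  rw [map_mul, signedConjHom, lift_apply_simple]
  rfl

theorem signedConjHom_one_apply (hra : IsRightAngled M) (p : W × ZMod 2) :
    cs.signedConjHom hra 1 p = p := by
  rw [map_one]
  rfl

theorem signedConjHom_apply (hra : IsRightAngled M) (w t : W) (e : ZMod 2) :
    cs.signedConjHom hra w (t, e) = (w * t * w⁻¹, e + cs.invParity hra w t) := by
  induction w using cs.simple_induction_left generalizing e with
  | one => simp [invParity, signedConjHom_one_apply]
  | mul_simple_left w i ih =>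
    rw [invParity, signedConjHom_simple_mul, signedConjHom_simple_mul, ih, ih]
    simp [signedConj, mul_assoc, add_assoc]

theorem invParity_mul (hra : IsRightAngled M) (v w t : W) :
    cs.invParity hra (v * w) t = cs.invParity hra w t + cs.invParity hra v (w * t * w⁻¹) := by
  have h : cs.signedConjHom hra (v * w) (t, 0) =
      cs.signedConjHom hra v (cs.signedConjHom hra w (t, 0)) := by
    rw [map_mul]; rfl
  rw [signedConjHom_apply, signedConjHom_apply, signedConjHom_apply] at h
  simpa using congrArg Prod.snd h

theorem invParity_simple (hra : IsRightAngled M) (i : B) (t : W) :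
    cs.invParity hra (cs.simple i) t = cs.simpleSign i t := by
  have h := signedConjHom_simple_mul (cs := cs) hra i 1 (t, 0)
  rw [mul_one] at h
  rw [invParity, h]
  simp [signedConj, signedConjHom_one_apply]

theorem invParity_one (hra : IsRightAngled M) (t : W) : cs.invParity hra 1 t = 0 := by
  simp [invParity, signedConjHom_one_apply]

theorem invParity_self (hra : IsRightAngled M) {t : W} (ht : cs.IsReflection t) :
    cs.invParity hra t t = 1 := by
  obtain ⟨w, i, rfl⟩ := ht
  have h := invParity_mul (cs := cs) hra w⁻¹ w (cs.simple i)
  rw [inv_mul_cancel, invParity_one] at h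
  rw [invParity_mul, invParity_mul, invParity_simple, simpleSign]
  have h1 : w⁻¹ * (w * cs.simple i * w⁻¹) * w⁻¹⁻¹ = cs.simple i := by group
  rw [h1, if_pos rfl, cs.inv_simple]
  have h2 : cs.simple i * cs.simple i * cs.simple i = cs.simple i := by simp
  rw [h2]
  linear_combination -h

theorem mem_rightInvSeq_of_invParity_ne_zero (hra : IsRightAngled M) (ω : List B) {t : W}
    (h : cs.invParity hra (cs.wordProd ω) t ≠ 0) : t ∈ cs.rightInvSeq ω := by
  induction ω with
  | nil => simp [invParity_one] at h
  | cons i ω ih =>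
    rw [wordProd_cons, invParity_mul, invParity_simple, simpleSign] at h
    rw [rightInvSeq, List.mem_cons]
    split_ifs at h with h'
    · left
      rw [← h']
      group
    · exact Or.inr (ih (by simpa using h))

theorem isRightInversion_of_invParity_ne_zero (hra : IsRightAngled M) {w t : W}
    (h : cs.invParity hra w t ≠ 0) : cs.IsRightInversion w t := by
  obtain ⟨ω, hω, rfl⟩ := cs.exists_isReduced w
  exact cs.isRightInversion_of_mem_rightInvSeq hω (mem_rightInvSeq_of_invParity_ne_zero hra ω h)

theorem isRightInversion_iff_invParity_ne_zero (hra : IsRightAngled M) {w t : W}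
    (ht : cs.IsReflection t) : cs.IsRightInversion w t ↔ cs.invParity hra w t ≠ 0 := by
  refine ⟨fun h h0 ↦ ?_, isRightInversion_of_invParity_ne_zero hra⟩
  refine ht.not_isRightInversion_mul_left_iff.2 h (isRightInversion_of_invParity_ne_zero hra ?_)
  rw [invParity_mul, invParity_self hra ht, ht.inv, ht.mul_self, one_mul, h0]
  decide

/-- Right multiplication by a simple reflection conjugates the other right inversions. -/
theorem isRightInversion_mul_simple_iff (hra : IsRightAngled M) {x t : W} {i : B}
    (ht : cs.IsReflection t) (hti : t ≠ cs.simple i) :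
    cs.IsRightInversion (x * cs.simple i) (cs.simple i * t * cs.simple i) ↔
      cs.IsRightInversion x t := by
  have ht' : cs.IsReflection (cs.simple i * t * cs.simple i) := by
    simpa using ht.conj (cs.simple i)
  rw [isRightInversion_iff_invParity_ne_zero hra ht', isRightInversion_iff_invParity_ne_zero hra ht,
    invParity_mul, invParity_simple, simpleSign, if_neg]
  · simp [mul_assoc]
  · intro h
    apply hti
    have := congrArg (fun u ↦ cs.simple i * u * cs.simple i) h
    simpa [mul_assoc] using this

/-! ### Bruhat order -/

theorem length_le_of_bruhatLE {x y : W} (h : bruhatLE cs x y) : cs.length x ≤ cs.length y := by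
  induction h with
  | refl => rfl
  | tail _ h ih =>
    obtain ⟨t, -, -, hl⟩ := h
    lia

theorem eq_of_bruhatLE_of_length_le {x y : W} (h : bruhatLE cs x y)
    (hl : cs.length y ≤ cs.length x) : x = y := by
  rcases Relation.ReflTransGen.cases_head h with h | ⟨z, ⟨t, -, -, hz⟩, h⟩
  · exact h
  · have := length_le_of_bruhatLE h
    lia

theorem bruhatLE_mul_simple {x : W} {i : B} (h : ¬ cs.IsRightDescent x i) :
    bruhatLE cs x (x * cs.simple i) := by
  refine .single ⟨_, cs.isReflection_simple i, rfl, ?_⟩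
  rw [not_isRightDescent_iff] at h
  lia

theorem mul_simple_bruhatLE {x : W} {i : B} (h : cs.IsRightDescent x i) :
    bruhatLE cs (x * cs.simple i) x := by
  simpa using bruhatLE_mul_simple (cs.isRightDescent_iff_not_isRightDescent_mul.1 h)

theorem bruhatStep_mul_simple (hra : IsRightAngled M) {x y : W} (h : bruhatStep cs x y) (i : B) :
    y = x * cs.simple i ∨ bruhatStep cs (x * cs.simple i) (y * cs.simple i) := by
  obtain ⟨t, ht, rfl, hl⟩ := h
  rcases eq_or_ne t (cs.simple i) with rfl | hti
  · exact .inl rfl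
  have hinv : cs.IsRightInversion (x * t) t := ⟨ht, by rwa [mul_assoc, ht.mul_self, mul_one]⟩
  obtain ⟨ht', hl'⟩ := (isRightInversion_mul_simple_iff hra (x := x * t) ht hti).2 hinv
  refine .inr ⟨_, ht', by simp [mul_assoc], ?_⟩
  have : x * t * cs.simple i * (cs.simple i * t * cs.simple i) = x * cs.simple i := by
    simp [mul_assoc, ht.mul_self, ← mul_assoc t t]
  rwa [this] at hl'

theorem bruhatLE_mul_simple_or (hra : IsRightAngled M) {x y : W} (h : bruhatLE cs x y) (i : B) :
    bruhatLE cs (x * cs.simple i) (y * cs.simple i) ∨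
      (bruhatLE cs (x * cs.simple i) y ∧ bruhatLE cs x (y * cs.simple i)) := by
  induction h using Relation.ReflTransGen.head_induction_on with
  | refl => exact .inl .refl
  | @head x z hxz hzy ih =>
    rcases bruhatStep_mul_simple hra hxz i with rfl | hstep
    · rw [simple_mul_simple_cancel_right] at ih
      rcases ih with ih | ih
      · exact .inr ⟨hzy, ih⟩
      · exact .inl ih.2
    · rcases ih with ih | ih
      · exact .inl (.head hstep ih)
      · exact .inr ⟨.head hstep ih.1, .head hxz ih.2⟩

/-- The lifting property. -/
theorem bruhatLE_lifting (hra : IsRightAngled M) {x y : W} {i : B} (h : bruhatLE cs x y)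
    (hx : ¬ cs.IsRightDescent x i) (hy : cs.IsRightDescent y i) :
    bruhatLE cs (x * cs.simple i) y ∧ bruhatLE cs x (y * cs.simple i) := by
  rcases bruhatLE_mul_simple_or hra h i with h | h
  · exact ⟨h.trans (mul_simple_bruhatLE hy), (bruhatLE_mul_simple hx).trans h⟩
  · exact h

theorem mul_simple_bruhatLE_mul_simple (hra : IsRightAngled M) {x y : W} {i : B}
    (h : bruhatLE cs x y) (hxy : cs.IsRightDescent x i ∨ ¬ cs.IsRightDescent y i) :
    bruhatLE cs (x * cs.simple i) (y * cs.simple i) := by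
  rcases bruhatLE_mul_simple_or hra h i with h | h
  · exact h
  · rcases hxy with hx | hy
    · exact (mul_simple_bruhatLE hx).trans h.2
    · exact h.1.trans (bruhatLE_mul_simple hy)

theorem mul_simple_bruhatCovBy_mul_simple (hra : IsRightAngled M) {x y : W} {i : B}
    (h : bruhatCovBy cs x y) (hx : cs.IsRightDescent x i) (hy : cs.IsRightDescent y i) :
    bruhatCovBy cs (x * cs.simple i) (y * cs.simple i) := by
  refine ⟨mul_simple_bruhatLE_mul_simple hra h.1 (.inl hx), ?_⟩
  have := h.2
  rw [isRightDescent_iff] at hx hy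
  lia

theorem mul_simple_eq_of_bruhatCovBy (hra : IsRightAngled M) {x y : W} {i : B}
    (h : bruhatCovBy cs x y) (hx : ¬ cs.IsRightDescent x i) (hy : cs.IsRightDescent y i) :
    x * cs.simple i = y := by
  refine eq_of_bruhatLE_of_length_le (bruhatLE_lifting hra h.1 hx hy).1 ?_
  have := h.2
  rw [not_isRightDescent_iff] at hx
  lia

theorem isRightDescent_mul_simple_iff (hra : IsRightAngled M) {x : W} {i j : B} (hij : M i j = 2)
    (h : cs.simple i ≠ cs.simple j) :
    cs.IsRightDescent (x * cs.simple j) i ↔ cs.IsRightDescent x i := by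
  have := isRightInversion_mul_simple_iff hra (x := x) (cs.isReflection_simple i) h
  rwa [← cs.simple_commute hij, simple_mul_simple_cancel_right,
    isRightInversion_simple_iff_isRightDescent,
    isRightInversion_simple_iff_isRightDescent] at this

/-! ### Infinite dihedral parabolic subgroups -/

open Classical in
/-- The retraction onto the infinite dihedral group generated by two simple reflections. -/
theorem exists_dihedralHom (hra : IsRightAngled M) {i j : B} (hij : M i j = 0) :
    ∃ f : W →* DihedralGroup 0,
      f (cs.simple i) = DihedralGroup.sr 0 ∧ f (cs.simple j) = DihedralGroup.sr 1 := by
  have hne : j ≠ i := by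
    rintro rfl
    simp at hij
  let g : B → DihedralGroup 0 := fun k ↦
    if k = i then DihedralGroup.sr 0 else if k = j then DihedralGroup.sr 1 else 1
  have hsq : ∀ k, g k * g k = 1 := by
    intro k
    simp only [g]
    split_ifs <;> simp
  have hg : M.IsLiftable g := by
    intro k l
    rcases eq_or_ne k l with rfl | hkl
    · simp [hsq]
    rcases hra k l hkl with h | h
    · have : g k = 1 ∨ g l = 1 := by
        have := M.symmetric i j
        simp only [g]
        grind
      rw [h, pow_two]
      rcases this with h | h <;> simp [h, hsq]
    · rw [h, pow_zero]
  exact ⟨cs.lift ⟨g, hg⟩, by simp [lift_apply_simple, g], by simp [lift_apply_simple, g, hne]⟩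

theorem wordProd_alternatingWord_ne (hra : IsRightAngled M) {i j : B} (hij : M i j = 0) {k : ℕ}
    (hk : k ≠ 0) : cs.wordProd (alternatingWord i j k) ≠ cs.wordProd (alternatingWord j i k) := by
  obtain ⟨f, hi, hj⟩ := exists_dihedralHom (cs := cs) hra hij
  intro h
  have h := congrArg f h
  rw [prod_alternatingWord_eq_mul_pow, prod_alternatingWord_eq_mul_pow] at h
  simp only [map_mul, map_pow, hi, hj, DihedralGroup.sr_mul_sr, DihedralGroup.r_pow] at h
  split_ifs at h with he
  · obtain ⟨m, rfl⟩ := he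
    simp only [map_one, one_mul, DihedralGroup.r.injEq] at h
    change ((1 : ℤ) - 0) * (((m + m) / 2 : ℕ) : ℤ) = ((0 : ℤ) - 1) * (((m + m) / 2 : ℕ) : ℤ) at h
    lia
  · simp only [hi, hj, DihedralGroup.sr_mul_r, DihedralGroup.sr.injEq] at h
    change (1 : ℤ) + ((1 : ℤ) - 0) * ((k / 2 : ℕ) : ℤ) =
      (0 : ℤ) + ((0 : ℤ) - 1) * ((k / 2 : ℕ) : ℤ) at h
    lia

theorem bruhatLE_mul_wordProd (hra : IsRightAngled M) {u : W} (ω : List B)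
    (hu : ∀ i ∈ ω, ¬ cs.IsRightDescent u i) : bruhatLE cs u (u * cs.wordProd ω) := by
  induction ω using List.reverseRecOn with
  | nil => simpa using .refl
  | append_singleton ω i ih =>
    have hi := hu i (by simp)
    rw [wordProd_append, wordProd_singleton, ← mul_assoc]
    rcases bruhatLE_mul_simple_or hra (ih fun j hj ↦ hu j (by simp [hj])) i with h | h
    · exact (bruhatLE_mul_simple hi).trans h
    · exact h.2

theorem exists_eq_mul_alternatingWord {x : W} {i j : B} (hx : cs.IsRightDescent x j) :
    ∃ (u : W) (k : ℕ), x = u * cs.wordProd (alternatingWord i j k) ∧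
      cs.length x = cs.length u + k ∧ k ≠ 0 ∧
      ¬ cs.IsRightDescent u i ∧ ¬ cs.IsRightDescent u j := by
  induction hn : cs.length x generalizing x i j with
  | zero =>
    rw [isRightDescent_iff] at hx
    lia
  | succ n ih =>
    have hl := cs.isRightDescent_iff.1 hx
    have hj := cs.isRightDescent_iff_not_isRightDescent_mul.1 hx
    by_cases hi : cs.IsRightDescent (x * cs.simple j) i
    · obtain ⟨u, k, hxu, hk, -, hui, huj⟩ := ih (i := j) hi (by lia)
      refine ⟨u, k + 1, ?_, by lia, by simp, huj, hui⟩
      rw [alternatingWord_succ, wordProd_concat, ← mul_assoc, ← hxu,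
        simple_mul_simple_cancel_right]
    · exact ⟨_, 1, by simp [alternatingWord], by lia, by simp, hi, hj⟩

/-- Two simple reflections generating an infinite dihedral group are never both right descents. -/
theorem not_isRightDescent_of_isRightDescent (hra : IsRightAngled M) {x : W} {i j : B}
    (hij : M i j = 0) (hi : cs.IsRightDescent x i) : ¬ cs.IsRightDescent x j := by
  intro hj
  obtain ⟨u, k, hu, hk, hk0, hui, huj⟩ := exists_eq_mul_alternatingWord (i := i) hj
  obtain ⟨v, l, hv, hl, -, hvj, hvi⟩ := exists_eq_mul_alternatingWord (i := j) hi
  have hmem : ∀ (i j : B) (k : ℕ), ∀ a ∈ alternatingWord i j k, a = i ∨ a = j := by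
    intro i j k
    induction k generalizing i j with
    | zero => simp [alternatingWord]
    | succ k ih =>
      intro a ha
      rw [alternatingWord_succ, List.concat_eq_append, List.mem_append, List.mem_singleton] at ha
      rcases ha with ha | ha
      · exact (ih j i a ha).symm
      · exact .inr ha
  have hasc : ∀ {u : W}, ¬ cs.IsRightDescent u i → ¬ cs.IsRightDescent u j → ∀ k l,
      bruhatLE cs u (u * cs.wordProd (alternatingWord i j k ++ (alternatingWord j i l).reverse)) ∧
      bruhatLE cs u (u * cs.wordProd (alternatingWord j i l ++ (alternatingWord i j k).reverse)) := by
    intro u hui huj k l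
    constructor <;> refine bruhatLE_mul_wordProd hra _ fun a ha ↦ ?_ <;>
    · have : a = i ∨ a = j := by
        rw [List.mem_append, List.mem_reverse] at ha
        rcases ha with ha | ha <;> have := hmem _ _ _ _ ha <;> tauto
      rcases this with rfl | rfl <;> assumption
  have huv := (hasc hui huj k l).1
  have hvu := (hasc hvi hvj k l).2
  rw [wordProd_append, wordProd_reverse, ← mul_assoc, ← hu, ← eq_mul_inv_of_mul_eq hv.symm] at huv
  rw [wordProd_append, wordProd_reverse, ← mul_assoc, ← hv, ← eq_mul_inv_of_mul_eq hu.symm] at hvu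
  obtain rfl := eq_of_bruhatLE_of_length_le huv (length_le_of_bruhatLE hvu)
  obtain rfl : k = l := by lia
  exact wordProd_alternatingWord_ne hra hij hk0 (mul_left_cancel (hu.symm.trans hv))

/-- If `i` is not a right descent of `y`, then at most one element covered by `y` has `i` as a right
descent. -/
theorem eq_of_bruhatCovBy_of_isRightDescent (hra : IsRightAngled M) {x₁ x₂ y : W} {i : B}
    (h₁ : bruhatCovBy cs x₁ y) (h₂ : bruhatCovBy cs x₂ y) (hx₁ : cs.IsRightDescent x₁ i)
    (hx₂ : cs.IsRightDescent x₂ i) (hy : ¬ cs.IsRightDescent y i) : x₁ = x₂ := by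
  induction hn : cs.length y generalizing x₁ x₂ y with
  | zero =>
    have := h₁.2
    lia
  | succ n ih =>
    have hy1 : y ≠ 1 := by
      rintro rfl
      simp at hn
    obtain ⟨j, hj⟩ := cs.exists_rightDescent_of_ne_one hy1
    have hs : cs.simple i ≠ cs.simple j := by
      intro h
      rw [IsRightDescent, h] at hy
      exact hy hj
    have hij : i ≠ j := fun h ↦ hs (congrArg _ h)
    rcases hra i j hij with h | h
    · have hdesc : ∀ {x : W}, bruhatCovBy cs x y → cs.IsRightDescent x i →
          cs.IsRightDescent x j := by
        intro x hxy hx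
        by_contra hxj
        have := mul_simple_eq_of_bruhatCovBy hra hxy hxj hj
        rw [← this, isRightDescent_mul_simple_iff hra h hs] at hy
        exact hy hx
      have hd₁ := hdesc h₁ hx₁
      have hd₂ := hdesc h₂ hx₂
      refine mul_right_cancel (b := cs.simple j) (ih
        (mul_simple_bruhatCovBy_mul_simple hra h₁ hd₁ hj)
        (mul_simple_bruhatCovBy_mul_simple hra h₂ hd₂ hj) ?_ ?_ ?_ ?_)
      · rwa [isRightDescent_mul_simple_iff hra h hs]
      · rwa [isRightDescent_mul_simple_iff hra h hs]
      · rwa [isRightDescent_mul_simple_iff hra h hs]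
      · rw [isRightDescent_iff] at hj
        lia
    · have e₁ := mul_simple_eq_of_bruhatCovBy hra h₁
        (not_isRightDescent_of_isRightDescent hra h hx₁) hj
      have e₂ := mul_simple_eq_of_bruhatCovBy hra h₂
        (not_isRightDescent_of_isRightDescent hra h hx₂) hj
      exact mul_right_cancel (e₁.trans e₂.symm)

/-! ### Butterflies -/

/-- If `i` is a right descent of `y₁` and `w` but not of `y₂`, then the butterfly is completed by
`y₂ * cs.simple i`. -/
theorem butterfly_mul_simple (hra : IsRightAngled M) {x₁ x₂ y₁ y₂ w : W} {i : B} (hx : x₁ ≠ x₂)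
    (h11 : bruhatCovBy cs x₁ y₁) (h12 : bruhatCovBy cs x₁ y₂)
    (h21 : bruhatCovBy cs x₂ y₁) (h22 : bruhatCovBy cs x₂ y₂) (hw₂ : bruhatLE cs y₂ w)
    (hw : cs.IsRightDescent w i) (hy₁ : cs.IsRightDescent y₁ i) (hy₂ : ¬ cs.IsRightDescent y₂ i) :
    bruhatCovBy cs y₁ (y₂ * cs.simple i) ∧ bruhatCovBy cs y₂ (y₂ * cs.simple i) ∧
      bruhatLE cs (y₂ * cs.simple i) w := by
  have hl := cs.not_isRightDescent_iff.1 hy₂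
  have hle : bruhatLE cs y₁ (y₂ * cs.simple i) := by
    have key : ∀ {x : W}, bruhatCovBy cs x y₁ → bruhatCovBy cs x y₂ → ¬ cs.IsRightDescent x i →
        bruhatLE cs y₁ (y₂ * cs.simple i) := by
      intro x h1 h2 hxi
      rw [← mul_simple_eq_of_bruhatCovBy hra h1 hxi hy₁]
      exact mul_simple_bruhatLE_mul_simple hra h2.1 (.inr hy₂)
    by_cases hx₁ : cs.IsRightDescent x₁ i
    · by_cases hx₂ : cs.IsRightDescent x₂ i
      · exact absurd (eq_of_bruhatCovBy_of_isRightDescent hra h12 h22 hx₁ hx₂ hy₂) hx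
      · exact key h21 h22 hx₂
    · exact key h11 h12 hx₁
  refine ⟨⟨hle, ?_⟩, ⟨bruhatLE_mul_simple hy₂, hl⟩, (bruhatLE_lifting hra hw₂ hy₂ hw).1⟩
  have := h11.2
  have := h12.2
  lia

/-- If `z` covers `y * cs.simple i` and `i` is a right descent of `y` but not of `z`, then
`z * cs.simple i` covers `y`. -/
theorem bruhatCovBy_mul_simple_of_bruhatCovBy (hra : IsRightAngled M) {y z : W} {i : B}
    (hy : cs.IsRightDescent y i) (h : bruhatCovBy cs (y * cs.simple i) z)
    (hz : ¬ cs.IsRightDescent z i) : bruhatCovBy cs y (z * cs.simple i) := by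
  refine ⟨by simpa using mul_simple_bruhatLE_mul_simple hra h.1 (.inr hz), ?_⟩
  have := h.2
  rw [isRightDescent_iff] at hy
  rw [not_isRightDescent_iff] at hz
  lia

theorem exists_bruhatCovBy_of_butterfly (hra : IsRightAngled M) {x₁ x₂ y₁ y₂ w : W} (hx : x₁ ≠ x₂)
    (hy : y₁ ≠ y₂) (h11 : bruhatCovBy cs x₁ y₁) (h12 : bruhatCovBy cs x₁ y₂)
    (h21 : bruhatCovBy cs x₂ y₁) (h22 : bruhatCovBy cs x₂ y₂)
    (hw₁ : bruhatLE cs y₁ w) (hw₂ : bruhatLE cs y₂ w) :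
    ∃ z : W, bruhatCovBy cs y₁ z ∧ bruhatCovBy cs y₂ z ∧ bruhatLE cs z w := by
  induction hn : cs.length w generalizing x₁ x₂ y₁ y₂ w with
  | zero =>
    have := h11.2
    have := length_le_of_bruhatLE hw₁
    lia
  | succ n ih =>
    have hw1 : w ≠ 1 := by
      rintro rfl
      simp at hn
    obtain ⟨i, hi⟩ := cs.exists_rightDescent_of_ne_one hw1
    have hlen : cs.length (w * cs.simple i) = n := by
      have := cs.isRightDescent_iff.1 hi
      lia
    by_cases hy₁ : cs.IsRightDescent y₁ i <;> by_cases hy₂ : cs.IsRightDescent y₂ i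
    · have hdesc : ∀ {x : W}, bruhatCovBy cs x y₁ → bruhatCovBy cs x y₂ →
          cs.IsRightDescent x i := by
        intro x h1 h2
        by_contra hxi
        exact hy ((mul_simple_eq_of_bruhatCovBy hra h1 hxi hy₁).symm.trans
          (mul_simple_eq_of_bruhatCovBy hra h2 hxi hy₂))
      have hx₁ := hdesc h11 h12
      have hx₂ := hdesc h21 h22
      obtain ⟨z, hz₁, hz₂, hzw⟩ := ih (fun h ↦ hx (mul_right_cancel h))
        (fun h ↦ hy (mul_right_cancel h))
        (mul_simple_bruhatCovBy_mul_simple hra h11 hx₁ hy₁)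
        (mul_simple_bruhatCovBy_mul_simple hra h12 hx₁ hy₂)
        (mul_simple_bruhatCovBy_mul_simple hra h21 hx₂ hy₁)
        (mul_simple_bruhatCovBy_mul_simple hra h22 hx₂ hy₂)
        (mul_simple_bruhatLE_mul_simple hra hw₁ (.inl hy₁))
        (mul_simple_bruhatLE_mul_simple hra hw₂ (.inl hy₂)) hlen
      have hz : ¬ cs.IsRightDescent z i := by
        intro hz
        have e₁ := mul_simple_eq_of_bruhatCovBy hra hz₁
          (cs.isRightDescent_iff_not_isRightDescent_mul.1 hy₁) hz
        have e₂ := mul_simple_eq_of_bruhatCovBy hra hz₂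
          (cs.isRightDescent_iff_not_isRightDescent_mul.1 hy₂) hz
        rw [simple_mul_simple_cancel_right] at e₁ e₂
        exact hy (e₁.trans e₂.symm)
      exact ⟨z * cs.simple i, bruhatCovBy_mul_simple_of_bruhatCovBy hra hy₁ hz₁ hz,
        bruhatCovBy_mul_simple_of_bruhatCovBy hra hy₂ hz₂ hz,
        (bruhatLE_lifting hra (hzw.trans (mul_simple_bruhatLE hi)) hz hi).1⟩
    · exact ⟨_, butterfly_mul_simple hra hx h11 h12 h21 h22 hw₂ hi hy₁ hy₂⟩
    · obtain ⟨h1, h2, h3⟩ := butterfly_mul_simple hra hx h12 h11 h22 h21 hw₁ hi hy₂ hy₁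
      exact ⟨_, h2, h1, h3⟩
    · obtain ⟨z, hz₁, hz₂, hzw⟩ := ih hx hy h11 h12 h21 h22 (bruhatLE_lifting hra hw₁ hy₁ hi).2
        (bruhatLE_lifting hra hw₂ hy₂ hi).2 hlen
      exact ⟨z, hz₁, hz₂, hzw.trans (mul_simple_bruhatLE hi)⟩

end CoxeterSystem

/-- In a right-angled Coxeter group, if `x₁, x₂ ⋖ y₁, y₂` form a butterfly and `w ≥ y₁, y₂`,
then there is a `z ≤ w` covering both `y₁` and `y₂`. -/
theorem stmt12 (cs : CoxeterSystem M W)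
    (hra : ∀ i j : B, i ≠ j → M i j = 2 ∨ M i j = 0)
    (x₁ x₂ y₁ y₂ : W) (hx : x₁ ≠ x₂) (hy : y₁ ≠ y₂)
    (h11 : bruhatCovBy cs x₁ y₁) (h12 : bruhatCovBy cs x₁ y₂)
    (h21 : bruhatCovBy cs x₂ y₁) (h22 : bruhatCovBy cs x₂ y₂)
    (w : W) (hw₁ : bruhatLE cs y₁ w) (hw₂ : bruhatLE cs y₂ w) :
    ∃ z : W, bruhatCovBy cs y₁ z ∧ bruhatCovBy cs y₂ z ∧ bruhatLE cs z w := by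
  exact exists_bruhatCovBy_of_butterfly hra hx hy h11 h12 h21 h22 hw₁ hw₂
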